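/- arXiv:2107.12861 — 4 statements merged into one kernel-verified Lean document; each statement's English description precedes it below -/
import Mathlib

section
/- Two words u, v ∈ A* represent the same element of the monoid Π₂ = Mon⟨a,b,c | (ab^i c)² = 1 (i ≥ 1)⟩ if and only if there exists a word z ∈ A* with u →*_{T₂} z and v →*_{T₂} z, where T₂ is the rewriting system with rules ((ab^i c)², ε) for all i ≥ 1. -/
open Computability

/-- The three-letter alphabet `A = {a, b, c}`. -/
inductive Letter : Type
  | a | b | c

/-- The word `a b^i c` as a list of letters. -/
def wdL (i : ℕ) : List Letter := [Letter.a] ++ List.replicate i Letter.b ++ [Letter.c]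

/-- One-step rewriting relation of the system `T₂ = {((a bⁱ c)², ε) : i ≥ 1}`:
`u →_{T₂} v` iff `u = x (a bⁱ c)² y` and `v = x y` for some words `x, y` and some `i ≥ 1`. -/
def Step (u v : List Letter) : Prop :=
  ∃ x y : List Letter, ∃ i : ℕ, 1 ≤ i ∧ u = x ++ (wdL i ++ wdL i) ++ y ∧ v = x ++ y

/-- The word `a b^i c` as an element of the free monoid on `A`. -/
def wd (i : ℕ) : FreeMonoid Letter := FreeMonoid.ofList (wdL i)

/-- The defining relations of `Π₂`: `(a bⁱ c)² = 1` for every `i ≥ 1`. -/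
def Pi2Rel (u v : FreeMonoid Letter) : Prop :=
  ∃ i : ℕ, 1 ≤ i ∧ u = wd i * wd i ∧ v = 1

/-- The least congruence on `A*` identifying `(a bⁱ c)²` with the empty word for all `i ≥ 1`. -/
def Pi2Con : Con (FreeMonoid Letter) := conGen Pi2Rel

/-- The monoid `Π₂ = Mon⟨a,b,c | (a bⁱ c)² = 1 (i ≥ 1)⟩`. -/
abbrev Pi2 := Pi2Con.Quotient

theorem aux_rep (i j : ℕ) (y z : List Letter)
    (h : List.replicate i Letter.b ++ Letter.c :: y = List.replicate j Letter.b ++ Letter.c :: z) :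
    i = j ∧ y = z := by
  induction i generalizing j with
  | zero =>
    cases j with
    | zero => simpa using h
    | succ j => simp [List.replicate_succ] at h
  | succ i ih =>
    cases j with
    | zero => simp [List.replicate_succ] at h
    | succ j =>
      simp only [List.replicate_succ, List.cons_append, List.cons.injEq, true_and] at h
      have := ih j h
      exact ⟨by omega, this.2⟩

theorem wdL_app (i : ℕ) (y : List Letter) :
    wdL i ++ y = Letter.a :: (List.replicate i Letter.b ++ Letter.c :: y) := by
  simp [wdL]

theorem wdL_inj (i j : ℕ) (y z : List Letter) (h : wdL i ++ y = wdL j ++ z) :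
    i = j ∧ y = z := by
  rw [wdL_app, wdL_app] at h
  exact aux_rep i j y z (List.cons.inj h).2

theorem aux_split (i : ℕ) (r t s : List Letter)
    (h : List.replicate i Letter.b ++ Letter.c :: r = t ++ Letter.a :: s) :
    ∃ t', t = List.replicate i Letter.b ++ Letter.c :: t' ∧ r = t' ++ Letter.a :: s := by
  induction i generalizing t with
  | zero =>
    cases t with
    | nil => simp at h
    | cons d t =>
      simp at h
      exact ⟨t, by simp [h.1], h.2⟩
  | succ i ih =>
    cases t with
    | nil => simp [List.replicate_succ] at h
    | cons d t =>
      simp only [List.replicate_succ, List.cons_append, List.cons.injEq] at h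
      obtain ⟨t', h1, h2⟩ := ih t h.2
      exact ⟨t', by simp [List.replicate_succ, h1, h.1], h2⟩

theorem wdL_split (i j : ℕ) (r t s : List Letter) (h : wdL i ++ r = t ++ (wdL j ++ s)) :
    t = [] ∨ ∃ t', t = wdL i ++ t' ∧ r = t' ++ (wdL j ++ s) := by
  cases t with
  | nil => exact Or.inl rfl
  | cons d t =>
    right
    rw [wdL_app, wdL_app, List.cons_append] at h
    obtain ⟨h1, h2⟩ := List.cons.inj h
    obtain ⟨t', h3, h4⟩ := aux_split i _ _ _ h2
    exact ⟨t', by rw [wdL_app, h3, h1], by rw [wdL_app, h4]⟩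

theorem diamond_aux (x y x' y' : List Letter) (i j : ℕ) (hi : 1 ≤ i) (hj : 1 ≤ j)
    (t : List Letter) (hx : x' = x ++ t)
    (h : wdL i ++ (wdL i ++ y) = t ++ (wdL j ++ (wdL j ++ y'))) :
    x ++ y = x' ++ y' ∨ ∃ d, Step (x ++ y) d ∧ Step (x' ++ y') d := by
  subst hx
  rcases wdL_split _ _ _ _ _ h with rfl | ⟨t', rfl, h'⟩
  · left
    obtain ⟨rfl, h1⟩ := wdL_inj _ _ _ _ h
    obtain ⟨-, h2⟩ := wdL_inj _ _ _ _ h1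
    simp [h2]
  · rcases wdL_split _ _ _ _ _ h' with rfl | ⟨t'', rfl, rfl⟩
    · left
      obtain ⟨rfl, h1⟩ := wdL_inj _ _ _ _ h'
      simp [h1]
    · right
      exact ⟨x ++ t'' ++ y', ⟨x ++ t'', y', j, hj, by simp, rfl⟩,
        ⟨x, t'' ++ y', i, hi, by simp, by simp⟩⟩

theorem Step_diamond (u v w : List Letter) (h1 : Step u v) (h2 : Step u w) :
    v = w ∨ ∃ d, Step v d ∧ Step w d := by
  obtain ⟨x, y, i, hi, rfl, rfl⟩ := h1
  obtain ⟨x', y', j, hj, h, rfl⟩ := h2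
  simp only [List.append_assoc] at h
  rcases List.append_eq_append_iff.1 h with ⟨t, ht, h'⟩ | ⟨t, ht, h'⟩
  · exact diamond_aux x y x' y' i j hi hj t ht h'
  · rcases diamond_aux x' y' x y j i hj hi t ht h' with h | ⟨d, h, h'⟩
    · exact Or.inl h.symm
    · exact Or.inr ⟨d, h', h⟩

theorem Step_join_equiv : Equivalence (Relation.Join (Relation.ReflTransGen Step)) := by
  apply Relation.equivalence_join_reflTransGen
  intro u v w h1 h2
  rcases Step_diamond u v w h1 h2 with rfl | ⟨d, h, h'⟩
  · exact ⟨v, .refl, .refl⟩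
  · exact ⟨d, .single h, .single h'⟩

theorem Step_ctx (p q u v : List Letter) (h : Relation.ReflTransGen Step u v) :
    Relation.ReflTransGen Step (p ++ u ++ q) (p ++ v ++ q) := by
  refine Relation.ReflTransGen.lift (fun z => p ++ z ++ q) ?_ _ _ h
  rintro _ _ ⟨x, y, i, hi, rfl, rfl⟩
  exact ⟨p ++ x, y ++ q, i, hi, by simp, by simp⟩

theorem Step_mul (u v u' v' : List Letter) (h : Relation.ReflTransGen Step u v)
    (h' : Relation.ReflTransGen Step u' v') :
    Relation.ReflTransGen Step (u ++ u') (v ++ v') := by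
  have h1 := Step_ctx [] u' u v h
  have h2 := Step_ctx v [] u' v' h'
  simp only [List.nil_append, List.append_nil] at h1 h2
  exact h1.trans h2

theorem Con_of_steps (u v : List Letter) (h : Relation.ReflTransGen Step u v) :
    Pi2Con (FreeMonoid.ofList u) (FreeMonoid.ofList v) := by
  induction h with
  | refl => exact Pi2Con.refl _
  | tail _ hs ih =>
    refine Pi2Con.trans ih ?_
    obtain ⟨x, y, i, hi, rfl, rfl⟩ := hs
    have h0 : Pi2Con (wd i * wd i) 1 := ConGen.Rel.of _ _ ⟨i, hi, rfl, rfl⟩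
    have := Pi2Con.mul (Pi2Con.mul (Pi2Con.refl (FreeMonoid.ofList x)) h0)
      (Pi2Con.refl (FreeMonoid.ofList y))
    rw [mul_one] at this
    exact this

theorem join_of_Con (u v : FreeMonoid Letter) (h : ConGen.Rel Pi2Rel u v) :
    Relation.Join (Relation.ReflTransGen Step) u.toList v.toList := by
  induction h with
  | of x y h =>
    obtain ⟨i, hi, rfl, rfl⟩ := h
    refine ⟨[], .single ⟨[], [], i, hi, ?_, rfl⟩, .refl⟩
    simp [wd]
  | refl x => exact Step_join_equiv.refl _
  | symm _ ih => exact Step_join_equiv.symm ih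
  | trans _ _ ih1 ih2 => exact Step_join_equiv.trans ih1 ih2
  | mul _ _ ih1 ih2 =>
    obtain ⟨z, h1, h2⟩ := ih1
    obtain ⟨z', h3, h4⟩ := ih2
    exact ⟨z ++ z', Step_mul _ _ _ _ h1 h3, Step_mul _ _ _ _ h2 h4⟩

/-- Two words represent the same element of `Π₂` iff they have a common `T₂`-descendant. -/
theorem Pi2_eq_iff_common_reduct (u v : List Letter) :
    Pi2Con (FreeMonoid.ofList u) (FreeMonoid.ofList v) ↔
      ∃ z : List Letter, Relation.ReflTransGen Step u z ∧ Relation.ReflTransGen Step v z := by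
  constructor
  · intro h
    exact join_of_Con _ _ h
  · rintro ⟨z, h1, h2⟩
    exact Pi2Con.trans (Con_of_steps _ _ h1) (Pi2Con.symm (Con_of_steps _ _ h2))
end

section
/- The element of Π₂ = Mon⟨a,b,c | (ab^i c)² = 1 (i ≥ 1)⟩ represented by the letter b is not a unit of Π₂. -/
open Computability

/-- A representation by self-maps of `ℕ` in which `a bⁱ c` acts trivially. -/
def repL : Letter → Function.End ℕ
  | Letter.a => fun n => n / 2
  | Letter.b => fun n => 2 * (n / 2)
  | Letter.c => fun n => 2 * n

def repF : FreeMonoid Letter →* Function.End ℕ := FreeMonoid.lift repL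

theorem repL_idem : repL Letter.b * repL Letter.b = repL Letter.b := by
  funext n
  change 2 * (2 * (n / 2) / 2) = 2 * (n / 2)
  omega

theorem repL_bc : repL Letter.b * repL Letter.c = repL Letter.c := by
  funext n
  change 2 * (2 * n / 2) = 2 * n
  omega

theorem repL_ac : repL Letter.a * repL Letter.c = 1 := by
  funext n
  change 2 * n / 2 = n
  omega

theorem repL_pow (i : ℕ) : repL Letter.b ^ i * repL Letter.c = repL Letter.c := by
  induction i with
  | zero => simp
  | succ k ih => rw [pow_succ, mul_assoc, repL_bc, ih]

theorem repF_wd (i : ℕ) : repF (wd i) = 1 := by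
  have : repF (wd i) = repL Letter.a * (repL Letter.b ^ i * repL Letter.c) := by
    simp [repF, wd, wdL, FreeMonoid.lift_apply]
  rw [this, repL_pow, repL_ac]

theorem repF_con : Pi2Con ≤ Con.ker repF := by
  apply Con.conGen_le.2
  rintro u v ⟨i, _, rfl, rfl⟩
  simp [Con.ker_rel, repF_wd]

/-- The element of `Π₂` represented by the letter `b` is not a unit. -/
theorem b_not_unit : ¬ IsUnit (Pi2Con.mk' (FreeMonoid.of Letter.b)) := by
  intro h
  have h2 : IsUnit (Pi2Con.lift repF repF_con (Pi2Con.mk' (FreeMonoid.of Letter.b))) :=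
    h.map (Pi2Con.lift repF repF_con)
  have e : Pi2Con.lift repF repF_con (Pi2Con.mk' (FreeMonoid.of Letter.b)) = repL Letter.b := by
    rw [Con.lift_mk']
    exact FreeMonoid.lift_eval_of _ _
  rw [e] at h2
  have h3 : repL Letter.b = 1 := by
    apply h2.mul_left_cancel
    rw [repL_idem, mul_one]
  have h4 := congrFun h3 1
  change 2 * (1 / 2) = 1 at h4
  omega
end

section
/- The special monoid Π₂ = Mon⟨a,b,c | (ab^i c)² = 1 (i ≥ 1)⟩ is a context-free monoid with non-finitely generated group of units: the language { u # rev(v) : u, v ∈ A*, u =_{Π₂} v } over A ∪ {#} is context-free, and the group of units of Π₂ is not finitely generated as a group. -/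
open Computability

/-- The word problem of `Π₂` (after Duncan & Gilman) over the alphabet `A ∪ {#}`, where the
extra symbol `#` is encoded as `none` and the letters of `A` as `some _`. -/
def WP2 : Language (Option Letter) :=
  {l | ∃ u v : List Letter, Pi2Con (FreeMonoid.ofList u) (FreeMonoid.ofList v) ∧
    l = u.map some ++ [none] ++ (v.map some).reverse}

namespace Pi2Proof

open Letter

/-- class of a word -/
def pr (u : List Letter) : Pi2 := Pi2Con.mk' (FreeMonoid.ofList u)

theorem pr_append (u v : List Letter) : pr (u ++ v) = pr u * pr v := by
  simp only [pr, FreeMonoid.ofList_append, map_mul]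

theorem pr_nil : pr [] = 1 := by
  simp only [pr, FreeMonoid.ofList_nil, map_one]

theorem pr_cons (x : Letter) (u : List Letter) : pr (x :: u) = pr [x] * pr u := by
  rw [← pr_append]; rfl

theorem pr_eq_iff (u v : List Letter) :
    pr u = pr v ↔ Pi2Con (FreeMonoid.ofList u) (FreeMonoid.ofList v) := by
  exact Con.eq Pi2Con

theorem pr_surj (g : Pi2) : ∃ u, pr u = g := by
  obtain ⟨x, rfl⟩ := Con.mk'_surjective g
  exact ⟨FreeMonoid.toList x, by simp [pr]⟩

theorem pr_rel (i : ℕ) (hi : 1 ≤ i) : pr (wdL i) * pr (wdL i) = 1 := by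
  rw [← pr_append, ← pr_nil, pr_eq_iff]
  exact ConGen.Rel.of _ _ ⟨i, hi, rfl, rfl⟩

theorem wdL_append (i : ℕ) (t : List Letter) :
    wdL i ++ t = a :: (List.replicate i b ++ c :: t) := by
  simp [wdL]

theorem bc_inj (i j : ℕ) (r r' : List Letter)
    (h : List.replicate i b ++ c :: r = List.replicate j b ++ c :: r') : i = j ∧ r = r' := by
  induction i generalizing j with
  | zero =>
    cases j with
    | zero => simpa using h
    | succ j => simp [List.replicate_succ] at h
  | succ i ih =>
    cases j with
    | zero => simp [List.replicate_succ] at h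
    | succ j =>
      simp only [List.replicate_succ, List.cons_append, List.cons.injEq, true_and] at h
      obtain ⟨h1, h2⟩ := ih j h
      exact ⟨by omega, h2⟩

theorem wdL_inj (i j : ℕ) (r r' : List Letter)
    (h : wdL i ++ r = wdL j ++ r') : i = j ∧ r = r' := by
  rw [wdL_append, wdL_append] at h
  exact bc_inj _ _ _ _ (List.cons.inj h).2

theorem bc_skip (i : ℕ) (z y s : List Letter)
    (h : List.replicate i b ++ c :: z = y ++ a :: s) : ∃ y', z = y' ++ a :: s := by
  induction i generalizing y with
  | zero =>
    cases y with
    | nil => simp at h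
    | cons x y =>
      simp only [List.replicate_zero, List.nil_append, List.cons_append, List.cons.injEq] at h
      exact ⟨y, h.2⟩
  | succ i ih =>
    cases y with
    | nil => simp [List.replicate_succ] at h
    | cons x y =>
      simp only [List.replicate_succ, List.cons_append, List.cons.injEq] at h
      exact ih y h.2

theorem wd_sq (i : ℕ) (t : List Letter) : wdL (i + 1) ++ (wdL (i + 1) ++ t) =
    a :: b :: (List.replicate i b ++ (c :: a :: (List.replicate i b ++ (b :: c :: t)))) := by
  have h : ∀ z, List.replicate (i + 1) b ++ z = List.replicate i b ++ b :: z := by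
    intro z; rw [List.replicate_succ']; simp
  rw [wdL_append, wdL_append, h (c :: t)]
  rfl

/-- left redex -/
def Red (w t : List Letter) : Prop := ∃ i, 1 ≤ i ∧ w = wdL i ++ (wdL i ++ t)

theorem Red.unique {w t t' : List Letter} (h : Red w t) (h' : Red w t') : t = t' := by
  obtain ⟨i, _, rfl⟩ := h
  obtain ⟨j, _, h⟩ := h'
  obtain ⟨rfl, h⟩ := wdL_inj _ _ _ _ h
  exact (wdL_inj _ _ _ _ h).2

open Classical in
/-- push a letter on the left of a reduced word -/
noncomputable def push (x : Letter) (w : List Letter) : List Letter :=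
  if h : ∃ t, Red (x :: w) t then h.choose else x :: w

theorem push_red {x : Letter} {w t : List Letter} (h : Red (x :: w) t) : push x w = t := by
  have h' : ∃ t, Red (x :: w) t := ⟨t, h⟩
  rw [push, dif_pos h']
  exact h'.choose_spec.unique h

theorem push_not {x : Letter} {w : List Letter} (h : ¬ ∃ t, Red (x :: w) t) :
    push x w = x :: w := by
  rw [push, dif_neg h]

theorem push_ne {x : Letter} (hx : x ≠ a) (w : List Letter) : push x w = x :: w := by
  apply push_not
  rintro ⟨t, i, _, h⟩
  rw [wdL_append] at h
  exact hx (List.cons.inj h).1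

/-- irreducible -/
def Irr (w : List Letter) : Prop := ∀ p s t, w = p ++ s → ¬ Red s t

theorem Irr.suffix {p s : List Letter} (h : Irr (p ++ s)) : Irr s := by
  intro q s' t e
  exact h (p ++ q) s' t (by rw [e, List.append_assoc])

theorem irr_nil : Irr [] := by
  rintro p s t e ⟨i, _, h⟩
  have : s = [] := by simpa using (List.append_eq_nil_iff.1 e.symm).2
  rw [this, wdL_append] at h
  exact absurd h (by simp)

theorem Irr.push {w : List Letter} (h : Irr w) (x : Letter) : Irr (push x w) := by
  by_cases hr : ∃ t, Red (x :: w) t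
  · obtain ⟨t, ht⟩ := hr
    rw [push_red ht]
    obtain ⟨i, _, e⟩ := ht
    rw [wdL_append] at e
    have e := (List.cons.inj e).2
    rw [e] at h
    have : List.replicate i b ++ c :: (wdL i ++ t) =
      (List.replicate i b ++ c :: wdL i) ++ t := by simp
    rw [this] at h
    exact h.suffix
  · rw [push_not hr]
    intro p s t e hs
    cases p with
    | nil => exact hr ⟨t, by rw [e]; exact hs⟩
    | cons y p => exact h p s t (List.cons.inj e).2 hs

/-- action of words -/
noncomputable def act (u w : List Letter) : List Letter := u.foldr push w

theorem act_nil (w : List Letter) : act [] w = w := rfl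
theorem act_cons (x : Letter) (u w : List Letter) : act (x :: u) w = push x (act u w) := rfl
theorem act_append (u v w : List Letter) : act (u ++ v) w = act u (act v w) := by
  simp [act]

theorem Irr.act {w : List Letter} (h : Irr w) (u : List Letter) : Irr (act u w) := by
  induction u with
  | nil => exact h
  | cons x u ih => exact ih.push x

theorem act_self {u : List Letter} (h : Irr u) : act u [] = u := by
  induction u with
  | nil => rfl
  | cons x u ih =>
    rw [act_cons, ih (Irr.suffix (p := [x]) h), push_not]
    rintro ⟨t, ht⟩
    exact h [] _ t rfl ht

theorem act_b (i : ℕ) (w : List Letter) :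
    act (List.replicate i b) w = List.replicate i b ++ w := by
  induction i with
  | zero => rfl
  | succ i ih =>
    rw [List.replicate_succ, act_cons, ih, push_ne (by simp)]; rfl

theorem act_wdL (i : ℕ) (w : List Letter) :
    act (wdL i) w = push a (List.replicate i b ++ c :: w) := by
  have : wdL i = a :: (List.replicate i b ++ [c]) := by simp [wdL]
  rw [this, act_cons, act_append, act_b, act_cons, act_nil, push_ne (x := c) (by simp)]

theorem act_wdL_pos (i : ℕ) (hi : 1 ≤ i) (t : List Letter) : act (wdL i) (wdL i ++ t) = t := by
  rw [act_wdL]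
  apply push_red
  exact ⟨i, hi, by rw [wdL_append i (wdL i ++ t)]⟩

theorem act_wdL_neg (i : ℕ) (w : List Letter) (h : ¬ ∃ t, w = wdL i ++ t) :
    act (wdL i) w = wdL i ++ w := by
  rw [act_wdL, push_not, wdL_append]
  rintro ⟨t, j, hj, e⟩
  rw [← wdL_append] at e
  obtain ⟨rfl, e⟩ := wdL_inj _ _ _ _ e
  exact h ⟨t, e⟩

theorem act_sq (i : ℕ) (hi : 1 ≤ i) (w : List Letter) (hw : Irr w) :
    act (wdL i ++ wdL i) w = w := by
  rw [act_append]
  by_cases h : ∃ t, w = wdL i ++ t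
  · obtain ⟨t, rfl⟩ := h
    rw [act_wdL_pos i hi, act_wdL_neg]
    rintro ⟨t', rfl⟩
    exact hw [] _ t' rfl ⟨i, hi, rfl⟩
  · rw [act_wdL_neg i w h, act_wdL_pos i hi]

/-- the congruence of equal action -/
def actCon : Con (FreeMonoid Letter) where
  r u v := ∀ w, Irr w → act u.toList w = act v.toList w
  iseqv := ⟨fun _ _ _ => rfl, fun h w hw => (h w hw).symm,
    fun h h' w hw => (h w hw).trans (h' w hw)⟩
  mul' := by
    intro u v u' v' h h' w hw
    simp only [FreeMonoid.toList_mul, act_append]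
    rw [h' w hw, h _ (hw.act _)]

theorem pr_act {u v : List Letter} (h : pr u = pr v) {w : List Letter} (hw : Irr w) :
    act u w = act v w := by
  rw [pr_eq_iff] at h
  have : Pi2Con ≤ actCon := by
    apply Con.conGen_le.2
    rintro x y ⟨i, hi, rfl, rfl⟩ w hw
    exact act_sq i hi w hw
  exact this h w hw

theorem pr_push (x : Letter) (w : List Letter) : pr (push x w) = pr (x :: w) := by
  by_cases hr : ∃ t, Red (x :: w) t
  · obtain ⟨t, ht⟩ := hr
    rw [push_red ht]
    obtain ⟨i, hi, e⟩ := ht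
    rw [e, pr_append, pr_append, ← mul_assoc, pr_rel i hi, one_mul]
  · rw [push_not hr]

theorem pr_nf (u : List Letter) : pr (act u []) = pr u := by
  induction u with
  | nil => rfl
  | cons x u ih => rw [act_cons, pr_push, pr_cons, ih, ← pr_cons]

/-! Units -/

/-- generator -/
def gen (i : ℕ) (hi : 1 ≤ i) : Pi2ˣ := ⟨pr (wdL i), pr (wdL i), pr_rel i hi, pr_rel i hi⟩

/-- the subgroup generated by the first generators -/
def sub (n : ℕ) : Subgroup Pi2ˣ := Subgroup.closure {g | ∃ i, ∃ hi : 1 ≤ i, i ≤ n ∧ g = gen i hi}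

theorem sub_mono {m n : ℕ} (h : m ≤ n) : sub m ≤ sub n := by
  apply Subgroup.closure_mono
  rintro g ⟨i, hi, h', e⟩
  exact ⟨i, hi, h'.trans h, e⟩

theorem act_avoid (r : List Letter) (h : ¬ ∃ j, 1 ≤ j ∧ ∃ t, a :: r = wdL j ++ t)
    (v : List Letter) : ∃ y, act v (a :: r) = y ++ a :: r := by
  induction v with
  | nil => exact ⟨[], rfl⟩
  | cons x v ih =>
    obtain ⟨y, hy⟩ := ih
    rw [act_cons, hy]
    by_cases hr : ∃ t, Red (x :: (y ++ a :: r)) t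
    · obtain ⟨t, ht⟩ := hr
      rw [push_red ht]
      obtain ⟨i, hi, e⟩ := ht
      rw [wdL_append] at e
      obtain ⟨y', e⟩ := bc_skip _ _ _ _ (List.cons.inj e).2.symm
      cases y' with
      | nil => exact absurd ⟨i, hi, t, e.symm⟩ h
      | cons z y' =>
        rw [wdL_append] at e
        exact bc_skip _ _ _ _ (List.cons.inj e).2
    · rw [push_not hr]
      exact ⟨x :: y, rfl⟩

theorem unit_mem (n : ℕ) : ∀ (w : List Letter), w.length ≤ n → Irr w → ∀ g : Pi2ˣ,
    (g : Pi2) = pr w → ∃ m, g ∈ sub m := by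
  induction n with
  | zero =>
    intro w hl _ g hg
    have : w = [] := by simpa using hl
    subst this
    have : g = 1 := Units.ext (by rw [hg, pr_nil]; rfl)
    exact ⟨0, this ▸ one_mem _⟩
  | succ n ih =>
    intro w hl hw g hg
    obtain ⟨v, hv⟩ := pr_surj (g⁻¹ : Pi2ˣ)
    have h1 : pr (w ++ v) = pr [] := by
      rw [pr_append, hv, ← hg, pr_nil, Units.mul_inv]
    have h2 : pr (v ++ w) = pr [] := by
      rw [pr_append, hv, ← hg, pr_nil, Units.inv_mul]
    have h1 := pr_act h1 irr_nil
    have h2 := pr_act h2 irr_nil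
    rw [act_append, act_nil] at h1 h2
    rw [act_self hw] at h2
    cases w with
    | nil => exact ih [] (by simp) irr_nil g hg
    | cons x r =>
      by_cases hx : x = a
      · subst hx
        by_cases h : ∃ j, 1 ≤ j ∧ ∃ t, a :: r = wdL j ++ t
        · obtain ⟨j, hj, t, e⟩ := h
          have hl' : (a :: r).length = (wdL j).length + t.length := by rw [e, List.length_append]
          have hj' : (wdL j).length = j + 2 := by simp [wdL]
          rw [e] at hw hg
          obtain ⟨m, hm⟩ := ih t (by omega) hw.suffix (gen j hj * g) (by
            rw [Units.val_mul, hg, pr_append, ← mul_assoc]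
            show pr (wdL j) * pr (wdL j) * pr t = pr t
            rw [pr_rel j hj, one_mul])
          refine ⟨max m j, ?_⟩
          have : gen j hj ∈ sub (max m j) :=
            Subgroup.subset_closure ⟨j, hj, le_max_right _ _, rfl⟩
          exact (Subgroup.mul_mem_cancel_left _ this).1 (sub_mono (le_max_left _ _) hm)
        · obtain ⟨y, hy⟩ := act_avoid r h v
          rw [hy] at h2
          simp at h2
      · rw [act_cons, push_ne hx] at h1
        simp at h1

/-- products of generator words -/
inductive P (n : ℕ) : List Letter → Prop
  | nil : P n []
  | cons (i : ℕ) (hi : i ≤ n) (t : List Letter) (h : P n t) : P n (wdL i ++ t)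

theorem P.tail {n i : ℕ} {t : List Letter} (h : P n (wdL i ++ t)) : i ≤ n ∧ P n t := by
  generalize e : wdL i ++ t = w at h
  cases h with
  | nil => rw [wdL_append] at e; simp at e
  | cons j hj t' h =>
    obtain ⟨rfl, rfl⟩ := wdL_inj _ _ _ _ e
    exact ⟨hj, h⟩

theorem P.act {n i : ℕ} (h1 : 1 ≤ i) (hi : i ≤ n) {w : List Letter} (h : P n w) :
    P n (act (wdL i) w) := by
  by_cases hw : ∃ t, w = wdL i ++ t
  · obtain ⟨t, rfl⟩ := hw
    rw [act_wdL_pos i h1]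
    exact h.tail.2
  · rw [act_wdL_neg i w hw]
    exact .cons i hi w h

/-- stabiliser property -/
def Stab (n : ℕ) (g : Pi2) : Prop :=
  ∀ u, pr u = g → ∀ w, Irr w → P n w → P n (Pi2Proof.act u w)

theorem Stab.mul {n : ℕ} {g h : Pi2} (hg : Stab n g) (hh : Stab n h) : Stab n (g * h) := by
  intro u hu w hw hp
  obtain ⟨x, rfl⟩ := pr_surj g
  obtain ⟨y, rfl⟩ := pr_surj h
  rw [← pr_append] at hu
  rw [pr_act hu hw, act_append]
  exact hg x rfl _ (hw.act _) (hh y rfl _ hw hp)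

theorem sub_stab {n : ℕ} {g : Pi2ˣ} (hg : g ∈ sub n) :
    Stab n (g : Pi2) ∧ Stab n ((g⁻¹ : Pi2ˣ) : Pi2) := by
  have key : ∀ i, 1 ≤ i → i ≤ n → Stab n (pr (wdL i)) := by
    intro i h1 hi u hu w hw hp
    rw [pr_act hu hw]
    exact hp.act h1 hi
  induction hg using Subgroup.closure_induction with
  | mem x hx =>
    obtain ⟨i, h1, hi, rfl⟩ := hx
    exact ⟨key i h1 hi, key i h1 hi⟩
  | one =>
    have : Stab n 1 := by
      intro u hu w hw hp
      rw [← pr_nil] at hu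
      rw [pr_act hu hw]; exact hp
    simpa using this
  | mul x y _ _ hx hy =>
    rw [mul_inv_rev, Units.val_mul, Units.val_mul]
    exact ⟨hx.1.mul hy.1, hy.2.mul hx.2⟩
  | inv x _ hx => rw [inv_inv]; exact hx.symm

theorem not_fg : ¬ Group.FG Pi2ˣ := by
  intro h
  obtain ⟨S, hS⟩ := Group.fg_def.1 h
  have hm : ∀ g : Pi2ˣ, ∃ m, g ∈ sub m := by
    intro g
    obtain ⟨u, hu⟩ := pr_surj g
    exact unit_mem _ (act u []) le_rfl (irr_nil.act u) g (by rw [pr_nf, hu])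
  choose f hf using hm
  have htop : sub (S.sup f) = ⊤ := by
    rw [eq_top_iff, ← hS, Subgroup.closure_le]
    intro g hg
    exact sub_mono (Finset.le_sup hg) (hf g)
  have hg : gen (S.sup f + 1) (by omega) ∈ sub (S.sup f) := by rw [htop]; trivial
  have := (sub_stab hg).1 (wdL (S.sup f + 1)) rfl [] irr_nil .nil
  rw [act_wdL_neg _ _ (by rintro ⟨t, ht⟩; rw [wdL_append] at ht; simp at ht)] at this
  have := this.tail.1
  omega

/-! Context-freeness -/

/-- `Gen true` is the set of words reducing to the empty word; `Gen false` the middle parts. -/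
inductive Gen : Bool → List Letter → Prop
  | nil : Gen true []
  | app {u v : List Letter} (hu : Gen true u) (hv : Gen true v) : Gen true (u ++ v)
  | big {u v w : List Letter} (hu : Gen true u) (hv : Gen false v) (hw : Gen true w) :
      Gen true (a :: (u ++ b :: (v ++ b :: (w ++ [c]))))
  | bb {u : List Letter} (hu : Gen false u) : Gen false (b :: (u ++ [b]))
  | left {u v : List Letter} (hu : Gen true u) (hv : Gen false v) : Gen false (u ++ v)
  | right {u v : List Letter} (hu : Gen false u) (hv : Gen true v) : Gen false (u ++ v)
  | mid {u : List Letter} (hu : Gen true u) : Gen false (c :: (u ++ [a]))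

/-- `D u w`: `u` is obtained from `w` by inserting trivial words. -/
inductive D : List Letter → List Letter → Prop
  | nil : D [] []
  | cons (x : Letter) {u w : List Letter} (h : D u w) : D (x :: u) (x :: w)
  | ins {e u w : List Letter} (he : Gen true e) (h : D u w) : D (e ++ u) w

theorem D.split {u w1 w2 : List Letter} (h : D u (w1 ++ w2)) :
    ∃ u1 u2, u = u1 ++ u2 ∧ D u1 w1 ∧ D u2 w2 := by
  generalize e : w1 ++ w2 = w at h
  induction h generalizing w1 with
  | nil =>
    obtain ⟨rfl, rfl⟩ := List.append_eq_nil_iff.1 e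
    exact ⟨[], [], rfl, .nil, .nil⟩
  | @cons x u w h ih =>
    cases w1 with
    | nil =>
      simp only [List.nil_append] at e
      subst e
      exact ⟨[], x :: u, rfl, .nil, h.cons x⟩
    | cons y w1 =>
      simp only [List.cons_append, List.cons.injEq] at e
      obtain ⟨rfl, e⟩ := e
      obtain ⟨u1, u2, rfl, h1, h2⟩ := ih e
      exact ⟨y :: u1, u2, rfl, h1.cons y, h2⟩
  | @ins e' u w he h ih =>
    obtain ⟨u1, u2, rfl, h1, h2⟩ := ih e
    exact ⟨e' ++ u1, u2, by simp, h1.ins he, h2⟩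

theorem D.gen {u : List Letter} (h : D u []) : Gen true u := by
  generalize e : [] = w at h
  induction h with
  | nil => exact .nil
  | cons => simp at e
  | ins he h ih => exact he.app (ih e)

theorem D.uncons {u w : List Letter} {x : Letter} (h : D u (x :: w)) :
    ∃ e u', Gen true e ∧ u = e ++ x :: u' ∧ D u' w := by
  generalize e : x :: w = w' at h
  induction h with
  | nil => simp at e
  | @cons y u w' h ih =>
    obtain ⟨rfl, rfl⟩ := List.cons.inj e
    exact ⟨[], u, .nil, rfl, h⟩
  | @ins e' u w he h ih =>
    obtain ⟨e1, u', h1, rfl, h2⟩ := ih e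
    exact ⟨e' ++ e1, u', he.app h1, by simp, h2⟩

theorem D.mid (i : ℕ) : ∀ {u v w : List Letter}, D u (List.replicate i b) → Gen false v →
    D w (List.replicate i b) → Gen false (u ++ (v ++ w)) := by
  induction i with
  | zero =>
    intro u v w hu hv hw
    exact .left hu.gen (.right hv hw.gen)
  | succ i ih =>
    intro u v w hu hv hw
    rw [List.replicate_succ] at hu
    rw [List.replicate_succ'] at hw
    obtain ⟨e, u', he, rfl, hu'⟩ := hu.uncons
    obtain ⟨p, q, rfl, hp, hq⟩ := hw.split
    obtain ⟨e', q', he', rfl, hq'⟩ := hq.uncons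
    have := Gen.left he (.right (.bb (.right (ih hu' hv hp) he')) hq'.gen)
    simpa using this

theorem D.main (i : ℕ) (hi : 1 ≤ i) {u t : List Letter} (h : D u (wdL i ++ (wdL i ++ t))) :
    D u t := by
  obtain ⟨i, rfl⟩ : ∃ j, i = j + 1 := ⟨i - 1, by omega⟩
  rw [wd_sq] at h
  obtain ⟨e0, u, h0, rfl, k1⟩ := h.uncons
  obtain ⟨e1, u, h1, rfl, k2⟩ := k1.uncons
  obtain ⟨p, u, rfl, hp, k3⟩ := k2.split
  obtain ⟨e2, u, h2, rfl, k4⟩ := k3.uncons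
  obtain ⟨e3, u, h3, rfl, k5⟩ := k4.uncons
  obtain ⟨q, u, rfl, hq, k6⟩ := k5.split
  obtain ⟨e4, u, h4, rfl, k7⟩ := k6.uncons
  obtain ⟨e5, u, h5, rfl, k8⟩ := k7.uncons
  have hN := D.mid i hp (.left h2 (.mid h3)) hq
  have := D.ins (h0.app (.big h1 (.right hN h4) h5)) k8
  simpa using this

theorem D.nf (u : List Letter) : D u (Pi2Proof.act u []) := by
  induction u with
  | nil => exact .nil
  | cons x u ih =>
    rw [act_cons]
    by_cases hr : ∃ t, Red (x :: Pi2Proof.act u []) t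
    · obtain ⟨t, ht⟩ := hr
      rw [push_red ht]
      obtain ⟨i, hi, e⟩ := ht
      have := ih.cons x
      rw [e] at this
      exact D.main i hi this
    · rw [push_not hr]
      exact ih.cons x

/-- nonterminals -/
inductive NT : Type
  | S | E | N | F | O

/-- terminal letter -/
abbrev tl (x : Letter) : Symbol (Option Letter) NT := .terminal (some x)
/-- nonterminal symbol -/
abbrev nt (x : NT) : Symbol (Option Letter) NT := .nonterminal x

open NT

/-- rules as pairs -/
def ruleList : List (ContextFreeRule (Option Letter) NT) :=
  [⟨S, [.terminal none]⟩,
   ⟨S, [tl a, nt S, tl a]⟩,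
   ⟨S, [tl b, nt S, tl b]⟩,
   ⟨S, [tl c, nt S, tl c]⟩,
   ⟨S, [nt E, nt S]⟩,
   ⟨S, [nt S, nt F]⟩,
   ⟨E, []⟩,
   ⟨E, [nt E, nt E]⟩,
   ⟨E, [tl a, nt E, tl b, nt N, tl b, nt E, tl c]⟩,
   ⟨N, [tl b, nt N, tl b]⟩,
   ⟨N, [nt E, nt N]⟩,
   ⟨N, [nt N, nt E]⟩,
   ⟨N, [tl c, nt E, tl a]⟩,
   ⟨F, []⟩,
   ⟨F, [nt F, nt F]⟩,
   ⟨F, [tl c, nt F, tl b, nt O, tl b, nt F, tl a]⟩,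
   ⟨O, [tl b, nt O, tl b]⟩,
   ⟨O, [nt O, nt F]⟩,
   ⟨O, [nt F, nt O]⟩,
   ⟨O, [tl a, nt F, tl c]⟩]

open Classical in
/-- the grammar -/
noncomputable def gr : ContextFreeGrammar (Option Letter) where
  NT := NT
  initial := S
  rules := ruleList.toFinset

theorem mem_rules (r : ContextFreeRule (Option Letter) NT) : r ∈ gr.rules ↔ r ∈ ruleList := by
  classical
  exact List.mem_toFinset

/-- derivation relation -/
def Der (u : List (Symbol (Option Letter) NT)) (v : List (Option Letter)) : Prop :=
  gr.Derives u (v.map Symbol.terminal)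

theorem Der.nil : Der [] [] := ContextFreeGrammar.Derives.refl _

theorem Der.t (x : Option Letter) {u : List (Symbol (Option Letter) NT)} {v : List (Option Letter)}
    (h : Der u v) : Der (.terminal x :: u) (x :: v) :=
  ContextFreeGrammar.Derives.append_left h [.terminal x]

theorem Der.n {x : NT} {u : List (Symbol (Option Letter) NT)} {w v : List (Option Letter)}
    (hx : Der [nt x] w) (h : Der u v) : Der (nt x :: u) (w ++ v) := by
  have h1 : gr.Derives ([nt x] ++ u) (w.map Symbol.terminal ++ u) :=
    ContextFreeGrammar.Derives.append_right hx u
  have h2 := ContextFreeGrammar.Derives.append_left h (w.map Symbol.terminal)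
  have := h1.trans h2
  rw [← List.map_append] at this
  exact this

theorem Der.r {x : NT} {o : List (Symbol (Option Letter) NT)} {w : List (Option Letter)}
    (hr : (⟨x, o⟩ : ContextFreeRule (Option Letter) NT) ∈ ruleList) (h : Der o w) :
    Der [nt x] w := by
  refine ContextFreeGrammar.Produces.trans_derives ?_ h
  exact ⟨_, (mem_rules _).2 hr, ContextFreeRule.Rewrites.input_output⟩

theorem Gen.der {k : Bool} {w : List Letter} (h : Gen k w) :
    Der [nt (if k then E else N)] (w.map some) ∧
    Der [nt (if k then F else O)] (w.reverse.map some) := by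
  induction h with
  | nil => exact ⟨.r (by simp [ruleList]) .nil, .r (by simp [ruleList]) .nil⟩
  | app _ _ hu hv =>
    constructor
    · have := Der.r (x := E) (by simp [ruleList]) (.n hu.1 (.n hv.1 .nil))
      simpa using this
    · have := Der.r (x := F) (by simp [ruleList]) (.n hv.2 (.n hu.2 .nil))
      simpa using this
  | big _ _ _ hu hv hw =>
    constructor
    · have := Der.r (x := E) (by simp [ruleList])
        (.t (some a) (.n hu.1 (.t (some b) (.n hv.1 (.t (some b) (.n hw.1 (.t (some c) .nil)))))))
      simpa using this
    · have := Der.r (x := F) (by simp [ruleList])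
        (.t (some c) (.n hw.2 (.t (some b) (.n hv.2 (.t (some b) (.n hu.2 (.t (some a) .nil)))))))
      simpa using this
  | bb _ hu =>
    constructor
    · have := Der.r (x := N) (by simp [ruleList]) (.t (some b) (.n hu.1 (.t (some b) .nil)))
      simpa using this
    · have := Der.r (x := O) (by simp [ruleList]) (.t (some b) (.n hu.2 (.t (some b) .nil)))
      simpa using this
  | left _ _ hu hv =>
    constructor
    · have := Der.r (x := N) (by simp [ruleList]) (.n hu.1 (.n hv.1 .nil))
      simpa using this
    · have := Der.r (x := O) (by simp [ruleList]) (.n hv.2 (.n hu.2 .nil))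
      simpa using this
  | right _ _ hu hv =>
    constructor
    · have := Der.r (x := N) (by simp [ruleList]) (.n hu.1 (.n hv.1 .nil))
      simpa using this
    · have := Der.r (x := O) (by simp [ruleList]) (.n hv.2 (.n hu.2 .nil))
      simpa using this
  | mid _ hu =>
    constructor
    · have := Der.r (x := N) (by simp [ruleList]) (.t (some c) (.n hu.1 (.t (some a) .nil)))
      simpa using this
    · have := Der.r (x := O) (by simp [ruleList]) (.t (some a) (.n hu.2 (.t (some c) .nil)))
      simpa using this

/-- word pairs derived from the initial symbol -/
def R (u v : List Letter) : Prop := Der [nt S] (u.map some ++ [none] ++ (v.map some).reverse)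

theorem R.nil : R [] [] := .r (by simp [ruleList]) (.t none .nil)

theorem R.cons (x : Letter) {u v : List Letter} (h : R u v) : R (x :: u) (x :: v) := by
  have := Der.r (x := S) (by cases x <;> simp [ruleList]) (.t (some x) (.n h (.t (some x) .nil)))
  simpa [R] using this

theorem R.left {e u v : List Letter} (he : Gen true e) (h : R u v) : R (e ++ u) v := by
  have := Der.r (x := S) (by simp [ruleList]) (.n he.der.1 (.n h .nil))
  simpa [R] using this

theorem R.right {e u v : List Letter} (he : Gen true e) (h : R u v) : R u (e ++ v) := by
  have := Der.r (x := S) (by simp [ruleList]) (.n h (.n he.der.2 .nil))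
  simpa [R] using this

theorem R.of_D {u v w : List Letter} (hu : D u w) (hv : D v w) : R u v := by
  induction hu generalizing v with
  | nil =>
    have := R.right hv.gen R.nil
    simpa using this
  | cons x h ih =>
    obtain ⟨e, v', he, rfl, hv1⟩ := hv.uncons
    exact ((ih hv1).cons x).right he
  | ins he h ih => exact (ih hv).left he

/-- interpretation of nonterminals -/
def I : NT → Language (Option Letter)
  | S => WP2
  | E => {l | ∃ u, pr u = 1 ∧ l = u.map some}
  | N => {l | ∃ u, (∃ i, pr u = pr (List.replicate i b ++ c :: a :: List.replicate i b)) ∧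
      l = u.map some}
  | F => {l | ∃ u, pr u = 1 ∧ l = (u.map some).reverse}
  | O => {l | ∃ u, (∃ i, pr u = pr (List.replicate i b ++ c :: a :: List.replicate i b)) ∧
      l = (u.map some).reverse}

/-- interpretation of symbols -/
def J : Symbol (Option Letter) NT → Language (Option Letter)
  | .terminal x => {[x]}
  | .nonterminal x => I x

/-- interpretation of strings -/
def K (u : List (Symbol (Option Letter) NT)) : Language (Option Letter) := (u.map J).prod

theorem K_append (u v : List (Symbol (Option Letter) NT)) : K (u ++ v) = K u * K v := by
  simp [K]

theorem K_cons (x : Symbol (Option Letter) NT) (v : List (Symbol (Option Letter) NT)) :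
    K (x :: v) = J x * K v := by
  simp [K]

theorem K_nil : K [] = 1 := rfl

theorem mem_t {x : Option Letter} {u : List (Symbol (Option Letter) NT)} {l : List (Option Letter)}
    (h : l ∈ K (.terminal x :: u)) : ∃ l', l' ∈ K u ∧ l = x :: l' := by
  rw [K_cons] at h
  obtain ⟨p, hp, q, hq, rfl⟩ := Language.mem_mul.1 h
  have hp : p = [x] := hp
  exact ⟨q, hq, by rw [hp]; rfl⟩

theorem mem_n {x : NT} {u : List (Symbol (Option Letter) NT)} {l : List (Option Letter)}
    (h : l ∈ K (nt x :: u)) : ∃ p, p ∈ I x ∧ ∃ l', l' ∈ K u ∧ l = p ++ l' := by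
  rw [K_cons] at h
  obtain ⟨p, hp, q, hq, rfl⟩ := Language.mem_mul.1 h
  exact ⟨p, hp, q, hq, rfl⟩

theorem mem_nil {l : List (Option Letter)} (h : l ∈ K []) : l = [] := h

theorem self_mem_K (w : List (Option Letter)) : w ∈ K (w.map Symbol.terminal) := by
  induction w with
  | nil => exact rfl
  | cons x w ih =>
    rw [List.map_cons, K_cons]
    exact Language.mem_mul.2 ⟨[x], rfl, w, ih, rfl⟩

theorem I_S {l : List (Option Letter)} :
    l ∈ I S ↔ ∃ u v, pr u = pr v ∧ l = u.map some ++ [none] ++ (v.map some).reverse := by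
  simp only [pr_eq_iff]
  exact Iff.rfl

theorem pr_big {u v w : List Letter} {i : ℕ} (hu : pr u = 1) (hw : pr w = 1)
    (hv : pr v = pr (List.replicate i b ++ c :: a :: List.replicate i b)) :
    pr (a :: (u ++ b :: (v ++ b :: (w ++ [c])))) = 1 := by
  rw [pr_cons, pr_append, hu, one_mul, pr_cons b, pr_append v, hv, pr_cons b (w ++ _),
    pr_append w, hw, one_mul, ← pr_append, ← pr_append, ← pr_append, ← pr_append,
    ← pr_rel (i + 1) (by omega), ← pr_append]
  congr 1
  have := wd_sq i []
  rw [List.append_nil] at this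
  rw [this]
  simp

theorem pr_bb {u : List Letter} {i : ℕ}
    (hv : pr u = pr (List.replicate i b ++ c :: a :: List.replicate i b)) :
    pr (b :: (u ++ [b])) =
      pr (List.replicate (i + 1) b ++ c :: a :: List.replicate (i + 1) b) := by
  rw [pr_cons, pr_append, hv, ← pr_append, ← pr_append]
  congr 1
  conv_rhs => rw [List.replicate_succ]
  simp [← List.replicate_succ', List.replicate_succ]

theorem pr_mid {u : List Letter} (hu : pr u = 1) :
    pr (c :: (u ++ [a])) = pr (List.replicate 0 b ++ c :: a :: List.replicate 0 b) := by
  rw [pr_cons, pr_append, hu, one_mul, ← pr_append]; rfl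

theorem rule_sound (r : ContextFreeRule (Option Letter) NT) (hr : r ∈ ruleList) :
    K r.output ≤ I r.input := by
  intro l hl
  simp only [ruleList, List.mem_cons, List.not_mem_nil, or_false] at hr
  rcases hr with rfl | rfl | rfl | rfl | rfl | rfl | rfl | rfl | rfl | rfl | rfl | rfl | rfl |
    rfl | rfl | rfl | rfl | rfl | rfl | rfl
  · obtain ⟨l, k1, rfl⟩ := mem_t hl
    obtain rfl := mem_nil k1
    exact I_S.2 ⟨[], [], rfl, rfl⟩
  iterate 3
    · obtain ⟨l, k2, rfl⟩ := mem_t hl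
      obtain ⟨p, hp, l, k3, rfl⟩ := mem_n k2
      obtain ⟨l, k4, rfl⟩ := mem_t k3
      obtain rfl := mem_nil k4
      obtain ⟨u, v, e, rfl⟩ := I_S.1 hp
      refine I_S.2 ⟨_ :: u, _ :: v, ?_, by simp; exact ⟨rfl, rfl⟩⟩
      rw [pr_cons, e, ← pr_cons]
  · obtain ⟨p, hp, l, k5, rfl⟩ := mem_n hl
    obtain ⟨q, hq, l, k6, rfl⟩ := mem_n k5
    obtain rfl := mem_nil k6
    obtain ⟨u, v, e, rfl⟩ := I_S.1 hq
    obtain ⟨x, hx, rfl⟩ := hp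
    exact I_S.2 ⟨x ++ u, v, by rw [pr_append, hx, one_mul, e], by simp⟩
  · obtain ⟨p, hp, l, k7, rfl⟩ := mem_n hl
    obtain ⟨q, hq, l, k8, rfl⟩ := mem_n k7
    obtain rfl := mem_nil k8
    obtain ⟨u, v, e, rfl⟩ := I_S.1 hp
    obtain ⟨x, hx, rfl⟩ := hq
    exact I_S.2 ⟨u, x ++ v, by rw [pr_append, hx, one_mul, e], by simp⟩
  · obtain rfl := mem_nil hl
    exact ⟨[], pr_nil, rfl⟩
  · obtain ⟨p, ⟨u, hu, rfl⟩, l, k9, rfl⟩ := mem_n hl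
    obtain ⟨q, ⟨v, hv, rfl⟩, l, k10, rfl⟩ := mem_n k9
    obtain rfl := mem_nil k10
    exact ⟨u ++ v, by rw [pr_append, hu, hv, one_mul], by simp⟩
  · obtain ⟨l, k11, rfl⟩ := mem_t hl
    obtain ⟨p, ⟨u, hu, rfl⟩, l, k12, rfl⟩ := mem_n k11
    obtain ⟨l, k13, rfl⟩ := mem_t k12
    obtain ⟨q, ⟨v, ⟨i, hv⟩, rfl⟩, l, k14, rfl⟩ := mem_n k13
    obtain ⟨l, k15, rfl⟩ := mem_t k14
    obtain ⟨p, ⟨w, hw, rfl⟩, l, k16, rfl⟩ := mem_n k15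
    obtain ⟨l, k17, rfl⟩ := mem_t k16
    obtain rfl := mem_nil k17
    exact ⟨_, pr_big hu hw hv, by simp⟩
  · obtain ⟨l, k18, rfl⟩ := mem_t hl
    obtain ⟨q, ⟨v, ⟨i, hv⟩, rfl⟩, l, k19, rfl⟩ := mem_n k18
    obtain ⟨l, k20, rfl⟩ := mem_t k19
    obtain rfl := mem_nil k20
    exact ⟨_, ⟨_, pr_bb hv⟩, by simp⟩
  · obtain ⟨p, ⟨u, hu, rfl⟩, l, k21, rfl⟩ := mem_n hl
    obtain ⟨q, ⟨v, ⟨i, hv⟩, rfl⟩, l, k22, rfl⟩ := mem_n k21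
    obtain rfl := mem_nil k22
    exact ⟨u ++ v, ⟨i, by rw [pr_append, hu, hv, one_mul]⟩, by simp⟩
  · obtain ⟨q, ⟨v, ⟨i, hv⟩, rfl⟩, l, k23, rfl⟩ := mem_n hl
    obtain ⟨p, ⟨u, hu, rfl⟩, l, k24, rfl⟩ := mem_n k23
    obtain rfl := mem_nil k24
    exact ⟨v ++ u, ⟨i, by rw [pr_append, hu, hv, mul_one]⟩, by simp⟩
  · obtain ⟨l, k25, rfl⟩ := mem_t hl
    obtain ⟨p, ⟨u, hu, rfl⟩, l, k26, rfl⟩ := mem_n k25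
    obtain ⟨l, k27, rfl⟩ := mem_t k26
    obtain rfl := mem_nil k27
    exact ⟨_, ⟨_, pr_mid hu⟩, by simp⟩
  · obtain rfl := mem_nil hl
    exact ⟨[], pr_nil, rfl⟩
  · obtain ⟨p, ⟨u, hu, rfl⟩, l, k28, rfl⟩ := mem_n hl
    obtain ⟨q, ⟨v, hv, rfl⟩, l, k29, rfl⟩ := mem_n k28
    obtain rfl := mem_nil k29
    exact ⟨v ++ u, by rw [pr_append, hu, hv, one_mul], by simp⟩
  · obtain ⟨l, k30, rfl⟩ := mem_t hl
    obtain ⟨p, ⟨u, hu, rfl⟩, l, k31, rfl⟩ := mem_n k30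
    obtain ⟨l, k32, rfl⟩ := mem_t k31
    obtain ⟨q, ⟨v, ⟨i, hv⟩, rfl⟩, l, k33, rfl⟩ := mem_n k32
    obtain ⟨l, k34, rfl⟩ := mem_t k33
    obtain ⟨p, ⟨w, hw, rfl⟩, l, k35, rfl⟩ := mem_n k34
    obtain ⟨l, k36, rfl⟩ := mem_t k35
    obtain rfl := mem_nil k36
    exact ⟨_, pr_big hw hu hv, by simp⟩
  · obtain ⟨l, k37, rfl⟩ := mem_t hl
    obtain ⟨q, ⟨v, ⟨i, hv⟩, rfl⟩, l, k38, rfl⟩ := mem_n k37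
    obtain ⟨l, k39, rfl⟩ := mem_t k38
    obtain rfl := mem_nil k39
    exact ⟨_, ⟨_, pr_bb hv⟩, by simp⟩
  · obtain ⟨q, ⟨v, ⟨i, hv⟩, rfl⟩, l, k40, rfl⟩ := mem_n hl
    obtain ⟨p, ⟨u, hu, rfl⟩, l, k41, rfl⟩ := mem_n k40
    obtain rfl := mem_nil k41
    exact ⟨u ++ v, ⟨i, by rw [pr_append, hu, hv, one_mul]⟩, by simp⟩
  · obtain ⟨p, ⟨u, hu, rfl⟩, l, k42, rfl⟩ := mem_n hl
    obtain ⟨q, ⟨v, ⟨i, hv⟩, rfl⟩, l, k43, rfl⟩ := mem_n k42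
    obtain rfl := mem_nil k43
    exact ⟨v ++ u, ⟨i, by rw [pr_append, hu, hv, mul_one]⟩, by simp⟩
  · obtain ⟨l, k44, rfl⟩ := mem_t hl
    obtain ⟨p, ⟨u, hu, rfl⟩, l, k45, rfl⟩ := mem_n k44
    obtain ⟨l, k46, rfl⟩ := mem_t k45
    obtain rfl := mem_nil k46
    exact ⟨_, ⟨_, pr_mid hu⟩, by simp⟩

theorem produces_sound {u v : List (Symbol (Option Letter) NT)} (h : gr.Produces u v) :
    K v ≤ K u := by
  obtain ⟨r, hr, h⟩ := h
  obtain ⟨p, q, rfl, rfl⟩ := h.exists_parts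
  have := rule_sound r ((mem_rules r).1 hr)
  have e : K [Symbol.nonterminal r.input] = I r.input := by
    simp [K, J]
  erw [K_append, K_append, K_append, K_append, e]
  gcongr

theorem derives_sound {u v : List (Symbol (Option Letter) NT)} (h : gr.Derives u v) :
    K v ≤ K u := by
  induction h with
  | refl => exact le_rfl
  | tail _ h ih => exact (produces_sound h).trans ih

theorem cf : WP2.IsContextFree := by
  refine ⟨gr, ?_⟩
  ext l
  constructor
  · intro h
    have h1 := derives_sound h (self_mem_K l)
    obtain ⟨p, hp, l', h', rfl⟩ := mem_n h1
    obtain rfl := mem_nil h'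
    rw [List.append_nil]
    exact hp
  · rintro ⟨u, v, h, rfl⟩
    have h := pr_act ((pr_eq_iff u v).2 h) irr_nil
    exact R.of_D (D.nf u) (h ▸ D.nf v)

end Pi2Proof

/-- `Π₂` is a context-free monoid with non-finitely generated group of units. -/
theorem Pi2_context_free_units_not_fg :
    WP2.IsContextFree ∧ ¬ Group.FG (Pi2ˣ) := by
  exact ⟨Pi2Proof.cf, Pi2Proof.not_fg⟩
end

section
/- Fix an integer n ≥ 1 and let Π_n = Mon⟨a,b,c | (ab^i c)^n = 1 (i ≥ 1)⟩. For any integers i₁, …, i_n ≥ 1, the word (ab^{i₁}c)(ab^{i₂}c)⋯(ab^{i_n}c) represents the identity element of Π_n if and only if i₁ = i₂ = ⋯ = i_n. -/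
open Computability

/-- The defining relations of `Π_n`: `(a bⁱ c)ⁿ = 1` for every `i ≥ 1`. -/
def PinRel (n : ℕ) (u v : FreeMonoid Letter) : Prop :=
  ∃ i : ℕ, 1 ≤ i ∧ u = wd i ^ n ∧ v = 1

/-- The least congruence on `A*` identifying `(a bⁱ c)ⁿ` with the empty word for all `i ≥ 1`;
its quotient is the monoid `Π_n = Mon⟨a,b,c | (a bⁱ c)ⁿ = 1 (i ≥ 1)⟩`. -/
def PinCon (n : ℕ) : Con (FreeMonoid Letter) := conGen (PinRel n)


/-- States: a value in `ZMod n` together with a stack. -/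
abbrev PSt (n : ℕ) := ZMod n × List (ℕ × ZMod n)

/-- Action of the letters. -/
def pact (n : ℕ) (f : ℕ → ZMod n) : Letter → Function.End (PSt n)
  | Letter.a => fun x => match x with
    | (z, []) => (z, [])
    | (_, (k, y) :: l) => (f k + y, l)
  | Letter.b => fun x => match x with
    | (z, []) => (z, [])
    | (z, (k, y) :: l) => (z, (k + 1, y) :: l)
  | Letter.c => fun x => (0, (0, x.1) :: x.2)

/-- Induced homomorphism. -/
def phom (n : ℕ) (f : ℕ → ZMod n) : FreeMonoid Letter →* Function.End (PSt n) :=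
  FreeMonoid.lift (pact n f)

/-- Translation. -/
def ptr (n : ℕ) (z : ZMod n) : Function.End (PSt n) := fun x => (z + x.1, x.2)

lemma pact_b_pow (n : ℕ) (f : ℕ → ZMod n) (i k : ℕ) (z y : ZMod n) (l : List (ℕ × ZMod n)) :
    ((pact n f Letter.b) ^ i : Function.End (PSt n)) (z, (k, y) :: l) = (z, (k + i, y) :: l) := by
  induction i generalizing k with
  | zero => rfl
  | succ i ih =>
    rw [pow_succ]
    change ((pact n f Letter.b) ^ i : Function.End (PSt n)) (z, (k + 1, y) :: l) = _
    rw [ih, show k + 1 + i = k + (i + 1) by omega]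

lemma wd_eq (i : ℕ) :
    wd i = FreeMonoid.of Letter.a * FreeMonoid.of Letter.b ^ i * FreeMonoid.of Letter.c := by
  have h : FreeMonoid.ofList (List.replicate i Letter.b) = FreeMonoid.of Letter.b ^ i := by
    induction i with
    | zero => rfl
    | succ i ih => rw [pow_succ', ← ih]; rfl
  rw [← h]; rfl

lemma phom_wd (n : ℕ) (f : ℕ → ZMod n) (i : ℕ) : phom n f (wd i) = ptr n (f i) := by
  rw [wd_eq, map_mul, map_mul, map_pow]
  simp only [phom, FreeMonoid.lift_eval_of]
  funext x
  change pact n f Letter.a (((pact n f Letter.b) ^ i : Function.End (PSt n))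
    (0, (0, x.1) :: x.2)) = _
  rw [pact_b_pow, Nat.zero_add]
  rfl

lemma ptr_zero (n : ℕ) : ptr n 0 = 1 := by
  funext x
  simp only [ptr, zero_add]
  rfl

lemma ptr_add (n : ℕ) (y z : ZMod n) : ptr n (y + z) = ptr n y * ptr n z := by
  funext x
  change (y + z + x.1, x.2) = (y + (z + x.1), x.2)
  rw [add_assoc]

lemma phom_prod (n : ℕ) (f : ℕ → ZMod n) (L : List ℕ) :
    phom n f ((L.map wd).prod) = ptr n ((L.map f).sum) := by
  induction L with
  | nil => simp [ptr_zero]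
  | cons i L ih => simp [ih, ptr_add, phom_wd]

lemma pin_le (n : ℕ) (f : ℕ → ZMod n) : PinCon n ≤ Con.ker (phom n f) := by
  refine Con.conGen_le.mpr ?_
  rintro u v ⟨i, -, rfl, rfl⟩
  rw [Con.ker_rel]
  have h := phom_prod n f (List.replicate n i)
  simp only [List.map_replicate, List.prod_replicate, List.sum_replicate] at h
  rw [h]
  simp [ptr_zero]

/-- For `n ≥ 1` and `i₁, …, i_n ≥ 1`, the word `(a b^{i₁} c)(a b^{i₂} c)⋯(a b^{i_n} c)`
represents the identity of `Π_n` iff `i₁ = i₂ = ⋯ = i_n`. -/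
theorem prod_eq_one_iff_all_eq (n : ℕ) (hn : 1 ≤ n) (idx : Fin n → ℕ)
    (hidx : ∀ t : Fin n, 1 ≤ idx t) :
    PinCon n ((List.ofFn fun t : Fin n => wd (idx t)).prod) 1 ↔
      ∀ s t : Fin n, idx s = idx t := by
  constructor
  · intro h s t
    have h1 := pin_le n (fun k => if k = idx t then 1 else 0) h
    rw [Con.ker_rel, map_one] at h1
    have h2 := phom_prod n (fun k => if k = idx t then 1 else 0) (List.ofFn idx)
    rw [List.map_ofFn, List.map_ofFn] at h2
    have h3 := h2.symm.trans h1
    have h4 := congrArg Prod.fst (congrFun h3 ((0, []) : PSt n))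
    change _ + (0 : ZMod n) = 0 at h4
    rw [add_zero, List.sum_ofFn] at h4
    simp only [Function.comp] at h4
    rw [Finset.sum_boole, ZMod.natCast_eq_zero_iff] at h4
    have h5 : 0 < (Finset.univ.filter fun x => idx x = idx t).card :=
      Finset.card_pos.mpr ⟨t, by simp⟩
    have h6 := Nat.le_of_dvd h5 h4
    have h7 : (Finset.univ.filter fun x => idx x = idx t) = Finset.univ :=
      Finset.eq_univ_of_card _ (le_antisymm (Finset.card_le_univ _) (by simpa using h6))
    have h8 := Finset.mem_univ s
    rw [← h7] at h8
    simpa using h8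
  · intro h
    have h0 : (fun t : Fin n => wd (idx t)) = fun _ => wd (idx ⟨0, hn⟩) := by
      funext t
      rw [h t ⟨0, hn⟩]
    rw [h0, List.ofFn_const, List.prod_replicate]
    exact ConGen.Rel.of _ _ ⟨_, hidx _, rfl, rfl⟩
end
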